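/- Let 𝒬 be a UCQ, R a disjunctive rule, μ_∨ a disjunctive piece-unifier of 𝒬 with R, and let F be the fact base β_∨(𝒬, R, μ_∨). Then there exists a trigger (R, h) on F such that α_∨(F, R, h) ⊨ 𝒬, i.e., each of the fact bases produced by the trigger application entails some CQ of 𝒬. -/

import Mathlib

/-! ## Basic syntax: terms, atoms, substitutions -/

/-- A term over variables `V` and constants `C`. -/
inductive FOTerm (V C : Type) where
  | var (v : V)
  | const (c : C)
deriving DecidableEq

/-- An atom `p(t_1,...,t_n)`. -/
structure FOAtom (P V C : Type) where
  pred : P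
  args : List (FOTerm V C)
deriving DecidableEq

/-- A substitution of variables by terms. -/
abbrev FOSubst (V C : Type) := V → FOTerm V C

variable {P V C : Type}

def FOTerm.applySub (u : FOSubst V C) : FOTerm V C → FOTerm V C
  | FOTerm.var v => u v
  | FOTerm.const c => FOTerm.const c

def FOAtom.applySub (u : FOSubst V C) (a : FOAtom P V C) : FOAtom P V C :=
  ⟨a.pred, a.args.map (FOTerm.applySub u)⟩

def applySubFS [DecidableEq P] [DecidableEq V] [DecidableEq C]
    (u : FOSubst V C) (S : Finset (FOAtom P V C)) : Finset (FOAtom P V C) :=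
  S.image (FOAtom.applySub u)

def FOTerm.varsOf [DecidableEq V] : FOTerm V C → Finset V
  | FOTerm.var v => {v}
  | FOTerm.const _ => ∅

def FOAtom.varsOf [DecidableEq V] (a : FOAtom P V C) : Finset V :=
  a.args.foldr (fun t acc => t.varsOf ∪ acc) ∅

/-- Variables occurring in a finite set of atoms. -/
def varsFS [DecidableEq V] (S : Finset (FOAtom P V C)) : Finset V :=
  S.sup FOAtom.varsOf

/-- Terms occurring in a finite set of atoms. -/
def termsFS [DecidableEq V] [DecidableEq C] (S : Finset (FOAtom P V C)) :
    Finset (FOTerm V C) :=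
  S.sup (fun a => a.args.toFinset)

/-- `h` is a homomorphism from the atom set `S₁` to the atom set `S₂`. -/
def IsHom (h : FOSubst V C) (S₁ S₂ : Finset (FOAtom P V C)) : Prop :=
  ∀ a ∈ S₁, a.applySub h ∈ S₂

/-- `S₂ ⊨ S₁` for atom sets viewed as existentially closed conjunctions:
there is a homomorphism from `S₁` to `S₂`. -/
def EntailsFS (S₂ S₁ : Finset (FOAtom P V C)) : Prop :=
  ∃ h : FOSubst V C, IsHom h S₁ S₂

/-! ## Disjunctive existential rules, triggers, chase step α -/

/-- A disjunctive existential rule `B → H₁ ∨ ... ∨ Hₙ`. -/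
structure DisjRule (P V C : Type) where
  body : Finset (FOAtom P V C)
  heads : List (Finset (FOAtom P V C))

/-- Well-formedness: non-empty body, at least one head disjunct, non-empty disjuncts. -/
def DisjRule.WF (R : DisjRule P V C) : Prop :=
  R.body.Nonempty ∧ R.heads ≠ [] ∧ ∀ H ∈ R.heads, H.Nonempty

/-- All variables of a rule. -/
def DisjRule.vars [DecidableEq V] (R : DisjRule P V C) : Finset V :=
  varsFS R.body ∪ R.heads.foldr (fun H acc => varsFS H ∪ acc) ∅

/-- A trigger `(R, h)` on `F`: `h` is a homomorphism from the body of `R` to `F`. -/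
def IsTrigger (R : DisjRule P V C) (h : FOSubst V C) (F : Finset (FOAtom P V C)) : Prop :=
  IsHom h R.body F

/-- `h'` is a safe extension of `h` for the head disjunct `H` of rule `R` w.r.t. the
fact base `F`: it agrees with `h` outside the existential variables of `H` and renames
the existential variables of `H` injectively to fresh variables. -/
def IsSafeExt [DecidableEq V] (F : Finset (FOAtom P V C)) (R : DisjRule P V C)
    (H : Finset (FOAtom P V C)) (h h' : FOSubst V C) : Prop :=
  (∀ v : V, v ∉ varsFS H \ varsFS R.body → h' v = h v) ∧
  (∀ v ∈ varsFS H \ varsFS R.body, ∃ w : V, h' v = FOTerm.var w ∧ w ∉ varsFS F) ∧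
  (∀ v ∈ varsFS H \ varsFS R.body, ∀ v' ∈ varsFS H \ varsFS R.body,
      h' v = h' v' → v = v')

/-- `L` is a result of the application `α_∨(F, R, h)` of the trigger `(R, h)` on `F`:
its `i`-th element is `F ∪ h^{safeᵢ}(Hᵢ)`. -/
def IsAlpha [DecidableEq P] [DecidableEq V] [DecidableEq C]
    (F : Finset (FOAtom P V C)) (R : DisjRule P V C) (h : FOSubst V C)
    (L : List (Finset (FOAtom P V C))) : Prop :=
  L.length = R.heads.length ∧
  ∀ (i : ℕ) (hi : i < L.length) (hi' : i < R.heads.length),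
    ∃ h' : FOSubst V C, IsSafeExt F R (R.heads.get ⟨i, hi'⟩) h h' ∧
      L.get ⟨i, hi⟩ = F ∪ applySubFS h' (R.heads.get ⟨i, hi'⟩)

/-! ## Partitions of terms (as equivalence relations), piece-unifiers -/

/-- A relation on terms, representing a partition of a set of terms (two terms are
related iff they belong to the same class). -/
abbrev TRel (V C : Type) := FOTerm V C → FOTerm V C → Prop

/-- Admissibility of a partition: no class contains two distinct constants. -/
def RelAdmissible (r : TRel V C) : Prop :=
  ∀ c c' : C, r (FOTerm.const c) (FOTerm.const c') → c = c'

/-- `u` is a substitution associated with the partition represented by `r`: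
it is constant on classes, maps each term to a member of its class (the selected term),
and gives priority to constants. -/
def IsAssocSub (r : TRel V C) (u : FOSubst V C) : Prop :=
  (∀ s t, r s t → s.applySub u = t.applySub u) ∧
  (∀ t, r t (t.applySub u)) ∧
  (∀ (v : V) (c : C), r (FOTerm.var v) (FOTerm.const c) → u v = FOTerm.const c)

/-- The data of a piece-unifier `(Q', H', P_u)`. -/
structure PieceUnif (P V C : Type) where
  Q' : Finset (FOAtom P V C)
  H' : Finset (FOAtom P V C)
  rel : TRel V C

/-- `μ` is a piece-unifier of the CQ `Q` with the conjunctive rule `B → H`. -/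
def IsPieceUnifier [DecidableEq P] [DecidableEq V] [DecidableEq C]
    (Q : Finset (FOAtom P V C)) (B H : Finset (FOAtom P V C))
    (μ : PieceUnif P V C) : Prop :=
  μ.Q'.Nonempty ∧ μ.Q' ⊆ Q ∧ μ.H' ⊆ H ∧
  Equivalence μ.rel ∧
  -- the partition is on the terms of Q' and H' (all other classes are singletons)
  (∀ s t, μ.rel s t → s = t ∨
      (s ∈ termsFS μ.Q' ∪ termsFS μ.H' ∧ t ∈ termsFS μ.Q' ∪ termsFS μ.H')) ∧
  RelAdmissible μ.rel ∧
  -- classes containing an existential variable of H' contain otherwise only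
  -- non-separating variables of Q'
  (∀ z ∈ varsFS μ.H' \ varsFS B, ∀ t, μ.rel (FOTerm.var z) t → t = FOTerm.var z ∨
      ∃ v : V, t = FOTerm.var v ∧ FOTerm.var v ∈ termsFS μ.Q' ∧ v ∉ varsFS (Q \ μ.Q')) ∧
  -- unification condition
  (∀ u : FOSubst V C, IsAssocSub μ.rel u → applySubFS u μ.Q' = applySubFS u μ.H')

/-- The join of a list of partitions (represented as relations): the equivalence
relation generated by their union. -/
def joinRel (rs : List (TRel V C)) : TRel V C :=
  Relation.EqvGen (fun s t => ∃ r ∈ rs, r s t)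

/-- The data of a disjunctive piece-unifier: the safe copies `Q₁, ..., Qₙ` together
with the conjunctive piece-unifiers `μ₁, ..., μₙ`. -/
structure DisjPieceUnif (P V C : Type) where
  Qs : List (Finset (FOAtom P V C))
  mus : List (PieceUnif P V C)

/-- The join of the partitions of a disjunctive piece-unifier. -/
def DisjPieceUnif.rel (μ : DisjPieceUnif P V C) : TRel V C :=
  joinRel (μ.mus.map PieceUnif.rel)

/-- `Qc` is a safe copy of `Q` (bijective renaming of its variables). -/
def IsSafeCopy [DecidableEq P] [DecidableEq V] [DecidableEq C]
    (Q Qc : Finset (FOAtom P V C)) : Prop :=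
  ∃ ρ : V → V, Function.Injective ρ ∧
    Qc = Q.image (FOAtom.applySub (fun v => FOTerm.var (ρ v)))

/-- `μ` is a disjunctive piece-unifier of the UCQ `𝒬` with the disjunctive rule `R`. -/
def IsDisjPieceUnifier [DecidableEq P] [DecidableEq V] [DecidableEq C]
    (𝒬 : Set (Finset (FOAtom P V C))) (R : DisjRule P V C)
    (μ : DisjPieceUnif P V C) : Prop :=
  μ.Qs.length = R.heads.length ∧ μ.mus.length = R.heads.length ∧
  -- each Qᵢ is a safe copy of a CQ of 𝒬, with variables disjoint from the rule
  -- and from the other copies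
  (∀ (i : ℕ) (hi : i < μ.Qs.length), ∃ Q ∈ 𝒬, IsSafeCopy Q (μ.Qs.get ⟨i, hi⟩)) ∧
  (∀ (i : ℕ) (hi : i < μ.Qs.length), Disjoint (varsFS (μ.Qs.get ⟨i, hi⟩)) R.vars) ∧
  (∀ (i j : ℕ) (hi : i < μ.Qs.length) (hj : j < μ.Qs.length), i ≠ j →
      Disjoint (varsFS (μ.Qs.get ⟨i, hi⟩)) (varsFS (μ.Qs.get ⟨j, hj⟩))) ∧
  -- each μᵢ is a piece-unifier of Qᵢ with B → Hᵢ
  (∀ (i : ℕ) (hi : i < R.heads.length) (hi1 : i < μ.Qs.length) (hi2 : i < μ.mus.length),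
      IsPieceUnifier (μ.Qs.get ⟨i, hi1⟩) R.body (R.heads.get ⟨i, hi⟩)
        (μ.mus.get ⟨i, hi2⟩)) ∧
  -- the join of the partitions is admissible
  RelAdmissible μ.rel

/-- `β_∨(𝒬, R, μ) = u(B) ∪ ⋃ᵢ u(Qᵢ ∖ Qᵢ')`, for `u` a substitution associated with
the join of the partitions of `μ`. -/
def betaRw [DecidableEq P] [DecidableEq V] [DecidableEq C]
    (R : DisjRule P V C) (μ : DisjPieceUnif P V C) (u : FOSubst V C) :
    Finset (FOAtom P V C) :=
  applySubFS u R.body ∪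
    (List.zipWith (fun Qi m => applySubFS u (Qi \ PieceUnif.Q' m)) μ.Qs μ.mus).foldr
      (· ∪ ·) ∅

/-! ## Semantics -/

/-- A first-order interpretation (with non-empty domain). -/
structure Interp (P V C : Type) where
  dom : Type
  nonempty : Nonempty dom
  rel : P → List dom → Prop
  cst : C → dom

def Interp.evalT (I : Interp P V C) (a : V → I.dom) : FOTerm V C → I.dom
  | FOTerm.var v => a v
  | FOTerm.const c => I.cst c

def Interp.satAtom (I : Interp P V C) (a : V → I.dom) (atm : FOAtom P V C) : Prop :=
  I.rel atm.pred (atm.args.map (I.evalT a))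

def Interp.satFS (I : Interp P V C) (a : V → I.dom) (S : Finset (FOAtom P V C)) : Prop :=
  ∀ atm ∈ S, I.satAtom a atm

/-- `I` is a model of the atom set `S` viewed as an existentially closed conjunction. -/
def Interp.modelsFB [DecidableEq V] (I : Interp P V C) (S : Finset (FOAtom P V C)) : Prop :=
  ∃ a : V → I.dom, I.satFS a S

/-- `I` satisfies the disjunctive existential rule `R`. -/
def Interp.satRule [DecidableEq V] (I : Interp P V C) (R : DisjRule P V C) : Prop :=
  ∀ a : V → I.dom, I.satFS a R.body →
    ∃ H ∈ R.heads, ∃ a' : V → I.dom,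
      (∀ v ∈ varsFS R.body, a' v = a v) ∧ I.satFS a' H

/-- First-order entailment `F, ℛ ⊨ 𝒬` of a UCQ from a fact base and a set of
disjunctive existential rules. -/
def SemEntails [DecidableEq V] (F : Finset (FOAtom P V C)) (ℛ : Set (DisjRule P V C))
    (𝒬 : Set (Finset (FOAtom P V C))) : Prop :=
  ∀ I : Interp P V C, I.modelsFB F → (∀ R ∈ ℛ, I.satRule R) →
    ∃ Q ∈ 𝒬, I.modelsFB Q

/-! ## Piece-rewriting -/

/-- `IsPieceRewriting ℛ 𝒬 𝒬'` holds when the UCQ `𝒬'` is obtained from the UCQ `𝒬`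
by a finite sequence of one-step piece-rewritings with rules of `ℛ`. -/
inductive IsPieceRewriting [DecidableEq P] [DecidableEq V] [DecidableEq C]
    (ℛ : Set (DisjRule P V C)) :
    Finset (Finset (FOAtom P V C)) → Finset (Finset (FOAtom P V C)) → Prop
  | refl (𝒬 : Finset (Finset (FOAtom P V C))) : IsPieceRewriting ℛ 𝒬 𝒬
  | step (𝒬 𝒬' : Finset (Finset (FOAtom P V C))) (R : DisjRule P V C)
      (μ : DisjPieceUnif P V C) (u : FOSubst V C) :
      IsPieceRewriting ℛ 𝒬 𝒬' → R ∈ ℛ →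
      IsDisjPieceUnifier (↑𝒬' : Set (Finset (FOAtom P V C))) R μ →
      IsAssocSub μ.rel u →
      IsPieceRewriting ℛ 𝒬 (insert (betaRw R μ u) 𝒬')

/-! ## Variables, terms and substitutions -/

theorem FOAtom.mem_varsOf [DecidableEq V] {a : FOAtom P V C} {v : V} :
    v ∈ a.varsOf ↔ FOTerm.var v ∈ a.args := by
  obtain ⟨p, l⟩ := a
  simp only [FOAtom.varsOf]
  induction l with
  | nil => simp
  | cons t l ih =>
    rw [List.foldr_cons, Finset.mem_union, ih, List.mem_cons]
    cases t <;> simp [FOTerm.varsOf]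

theorem mem_varsFS [DecidableEq V] {S : Finset (FOAtom P V C)} {v : V} :
    v ∈ varsFS S ↔ ∃ a ∈ S, FOTerm.var v ∈ a.args := by
  simp [varsFS, Finset.mem_sup, FOAtom.mem_varsOf]

theorem mem_termsFS [DecidableEq V] [DecidableEq C] {S : Finset (FOAtom P V C)}
    {t : FOTerm V C} : t ∈ termsFS S ↔ ∃ a ∈ S, t ∈ a.args := by
  simp [termsFS, Finset.mem_sup]

theorem var_mem_termsFS [DecidableEq V] [DecidableEq C] {S : Finset (FOAtom P V C)} {v : V} :
    FOTerm.var v ∈ termsFS S ↔ v ∈ varsFS S := by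
  rw [mem_termsFS, mem_varsFS]

theorem varsFS_mono [DecidableEq V] {S T : Finset (FOAtom P V C)} (h : S ⊆ T) :
    varsFS S ⊆ varsFS T :=
  Finset.sup_mono h

theorem DisjRule.varsFS_head_subset [DecidableEq V] {R : DisjRule P V C}
    {H : Finset (FOAtom P V C)} (hH : H ∈ R.heads) : varsFS H ⊆ R.vars := by
  refine Finset.Subset.trans ?_ Finset.subset_union_right
  generalize R.heads = l at hH
  induction l with
  | nil => simp at hH
  | cons K l ih =>
    rcases List.mem_cons.1 hH with rfl | hH
    · exact Finset.subset_union_left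
    · exact (ih hH).trans Finset.subset_union_right

theorem FOAtom.applySub_congr {g g' : FOSubst V C} {a : FOAtom P V C}
    (h : ∀ v, FOTerm.var v ∈ a.args → g v = g' v) : a.applySub g = a.applySub g' := by
  simp only [FOAtom.applySub, FOAtom.mk.injEq, true_and]
  refine List.map_congr_left fun t ht => ?_
  cases t with
  | var v => exact h v ht
  | const c => rfl

theorem FOAtom.applySub_comp (ρ g : FOSubst V C) (a : FOAtom P V C) :
    (a.applySub ρ).applySub g = a.applySub (fun v => (ρ v).applySub g) := by
  simp only [FOAtom.applySub, List.map_map, FOAtom.mk.injEq, true_and]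
  refine List.map_congr_left fun t _ => ?_
  cases t <;> rfl

theorem EntailsFS.of_isSafeCopy [DecidableEq P] [DecidableEq V] [DecidableEq C]
    {G Q Qc : Finset (FOAtom P V C)} (hQ : IsSafeCopy Q Qc) (h : EntailsFS G Qc) :
    EntailsFS G Q := by
  obtain ⟨ρ, -, rfl⟩ := hQ
  obtain ⟨g, hg⟩ := h
  refine ⟨fun v => g (ρ v), fun a ha => ?_⟩
  have := hg _ (Finset.mem_image_of_mem _ ha)
  rwa [FOAtom.applySub_comp] at this

/-! ## Existence of associated substitutions and of safe extensions -/

/-- Every admissible partition has an associated substitution. -/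
theorem exists_isAssocSub {r : TRel V C} (hr : Equivalence r) (hadm : RelAdmissible r) :
    ∃ u : FOSubst V C, IsAssocSub r u := by
  classical
  have key : ∀ t : FOTerm V C, ∃ s, r t s ∧ ∀ c, r t (FOTerm.const c) → s = FOTerm.const c := by
    intro t
    by_cases h : ∃ c, r t (FOTerm.const c)
    · obtain ⟨c, hc⟩ := h
      exact ⟨_, hc, fun c' hc' => congrArg _ (hadm _ _ (hr.trans (hr.symm hc) hc'))⟩
    · exact ⟨t, hr.refl t, fun c hc => (h ⟨c, hc⟩).elim⟩
  choose f hf hfc using key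
  let S : Setoid (FOTerm V C) := ⟨r, hr⟩
  let sel : FOTerm V C → FOTerm V C := fun t => f (Quotient.mk S t).out
  have hout : ∀ t, r t (Quotient.mk S t).out := fun t => hr.symm (Quotient.mk_out (s := S) t)
  have hsel : ∀ t c, r t (FOTerm.const c) → sel t = FOTerm.const c := fun t c h =>
    hfc _ c (hr.trans (hr.symm (hout t)) h)
  have happ : ∀ t : FOTerm V C, t.applySub (fun v => sel (FOTerm.var v)) = sel t := by
    intro t
    cases t with
    | var v => rfl
    | const c => exact (hsel _ c (hr.refl _)).symm
  refine ⟨fun v => sel (FOTerm.var v), fun s t hst => ?_, fun t => ?_, fun v c h => hsel _ c h⟩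
  · rw [happ, happ]
    exact congrArg (fun q => f (Quotient.out q)) (Quotient.sound (s := S) hst)
  · rw [happ]
    exact hr.trans (hout t) (hf _)

theorem exists_isSafeExt [DecidableEq V] [Infinite V] (F : Finset (FOAtom P V C))
    (R : DisjRule P V C) (H : Finset (FOAtom P V C)) (h : FOSubst V C) :
    ∃ h' : FOSubst V C, IsSafeExt F R H h h' := by
  have : Infinite {w : V // w ∉ varsFS F} := (varsFS F).finite_toSet.infinite_compl.to_subtype
  let E := varsFS H \ varsFS R.body
  let e : E ↪ {w : V // w ∉ varsFS F} :=
    E.equivFin.toEmbedding.trans (Fin.valEmbedding.trans (Infinite.natEmbedding _))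
  refine ⟨fun v => if hv : v ∈ E then FOTerm.var (e ⟨v, hv⟩).1 else h v,
    fun v hv => dif_neg hv, fun v hv => ⟨_, dif_pos hv, (e ⟨v, hv⟩).2⟩, fun v hv v' hv' heq => ?_⟩
  have heq := ((dif_pos hv).symm.trans heq).trans (dif_pos hv')
  rw [FOTerm.var.injEq] at heq
  exact congrArg Subtype.val (e.injective (Subtype.ext heq))

/-! ## Piece-unifiers and the rewriting step -/

section PieceUnifier

variable [DecidableEq P] [DecidableEq V] [DecidableEq C]

/-- Each atom of `Q'` is unified argumentwise with some atom of `H'`. -/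
theorem IsPieceUnifier.exists_forall₂ {Q B H : Finset (FOAtom P V C)} {m : PieceUnif P V C}
    (hm : IsPieceUnifier Q B H m) {a : FOAtom P V C} (ha : a ∈ m.Q') :
    ∃ b ∈ m.H', a.pred = b.pred ∧ List.Forall₂ m.rel a.args b.args := by
  obtain ⟨-, -, -, heqv, -, hadm, -, hunif⟩ := hm
  obtain ⟨w, hw⟩ := exists_isAssocSub heqv hadm
  have hmem : a.applySub w ∈ applySubFS w m.H' := by
    rw [← hunif w hw]
    exact Finset.mem_image_of_mem _ ha
  obtain ⟨b, hb, hba⟩ := Finset.mem_image.1 hmem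
  simp only [FOAtom.applySub, FOAtom.mk.injEq] at hba
  refine ⟨b, hb, hba.1.symm, ?_⟩
  have hall : List.Forall₂ (· = ·) (a.args.map (FOTerm.applySub w))
      (b.args.map (FOTerm.applySub w)) := by
    rw [hba.2]
    exact List.forall₂_same.2 fun _ _ => rfl
  rw [List.forall₂_map_left_iff, List.forall₂_map_right_iff] at hall
  refine hall.imp fun s t hst => ?_
  have hs := hw.2.1 s
  rw [hst] at hs
  exact heqv.trans hs (heqv.symm (hw.2.1 t))

/-- If `u` is constant on the classes of a piece-unifier of `Q` with `B → H`, and `h'` is a safe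
extension of `u` for `H`, then any `F` containing `u(Q ∖ Q')` satisfies `F ∪ h'(H) ⊨ Q`. -/
theorem IsPieceUnifier.entailsFS {R : DisjRule P V C} {Q H F : Finset (FOAtom P V C)}
    {m : PieceUnif P V C} (hm : IsPieceUnifier Q R.body H m) (hH : H ∈ R.heads)
    (hdisj : Disjoint (varsFS Q) R.vars) {u h' : FOSubst V C}
    (hu : ∀ s t, m.rel s t → s.applySub u = t.applySub u)
    (hF : applySubFS u (Q \ m.Q') ⊆ F) (hsafe : IsSafeExt F R H u h') :
    EntailsFS (F ∪ applySubFS h' H) Q := by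
  classical
  have hunif := fun a => hm.exists_forall₂ (a := a)
  obtain ⟨-, hQ', hH', heqv, -, -, hex, -⟩ := hm
  have hHR : varsFS m.H' ⊆ R.vars := (varsFS_mono hH').trans (R.varsFS_head_subset hH)
  have hne : ∀ v ∈ varsFS Q, v ∉ varsFS m.H' := fun v hv hv' =>
    Finset.disjoint_left.1 hdisj hv (hHR hv')
  have huniq : ∀ z ∈ varsFS m.H' \ varsFS R.body, ∀ s ∈ termsFS m.H',
      m.rel (FOTerm.var z) s → s = FOTerm.var z := by
    intro z hz s hs hzs
    rcases hex z hz s hzs with h | ⟨v, rfl, hv, -⟩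
    · exact h
    · exact (hne v (varsFS_mono hQ' (var_mem_termsFS.1 hv)) (var_mem_termsFS.1 hs)).elim
  let g : FOSubst V C := fun v =>
    if h : ∃ z ∈ varsFS m.H' \ varsFS R.body, m.rel (FOTerm.var z) (FOTerm.var v)
    then h' h.choose else u v
  have hg : ∀ s ∈ termsFS m.H', ∀ t ∈ termsFS m.Q', m.rel t s →
      t.applySub g = s.applySub h' := by
    intro s hs t ht hts
    by_cases hse : ∃ z ∈ varsFS m.H' \ varsFS R.body, s = FOTerm.var z
    · obtain ⟨z, hz, rfl⟩ := hse
      have hv : ∃ v, t = FOTerm.var v := by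
        rcases hex z hz t (heqv.symm hts) with h | ⟨v, h, -⟩
        exacts [⟨z, h⟩, ⟨v, h⟩]
      obtain ⟨v, rfl⟩ := hv
      have h : ∃ z ∈ varsFS m.H' \ varsFS R.body, m.rel (FOTerm.var z) (FOTerm.var v) :=
        ⟨z, hz, heqv.symm hts⟩
      have hzz := huniq _ h.choose_spec.1 _ hs (heqv.trans h.choose_spec.2 hts)
      rw [FOTerm.var.injEq] at hzz
      simp only [FOTerm.applySub, g]
      rw [dif_pos h, ← hzz]
    · have hsu : s.applySub h' = s.applySub u := by
        cases s with
        | const c => rfl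
        | var w =>
          refine hsafe.1 w fun hw => hse ⟨w, ?_, rfl⟩
          exact Finset.mem_sdiff.2 ⟨var_mem_termsFS.1 hs, (Finset.mem_sdiff.1 hw).2⟩
      rw [hsu, ← hu t s hts]
      cases t with
      | const c => rfl
      | var v =>
        refine dif_neg ?_
        rintro ⟨z, hz, hzv⟩
        exact hse ⟨z, hz, huniq z hz s hs (heqv.trans hzv hts)⟩
  refine ⟨g, fun a ha => ?_⟩
  by_cases haQ : a ∈ m.Q'
  · obtain ⟨b, hb, hp, hall⟩ := hunif a haQ
    refine Finset.mem_union_right _ (Finset.mem_image.2 ⟨b, hH' hb, ?_⟩)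
    simp only [FOAtom.applySub, FOAtom.mk.injEq]
    refine ⟨hp.symm, ?_⟩
    rw [← List.forall₂_eq_eq_eq, List.forall₂_map_left_iff, List.forall₂_map_right_iff]
    rw [List.forall₂_iff_get] at hall ⊢
    refine ⟨hall.1.symm, fun i h₁ h₂ => ?_⟩
    exact (hg _ (mem_termsFS.2 ⟨b, hb, List.get_mem _ _⟩) _
      (mem_termsFS.2 ⟨a, haQ, List.get_mem _ _⟩) (hall.2 i h₂ h₁)).symm
  · have haD : a ∈ Q \ m.Q' := Finset.mem_sdiff.2 ⟨ha, haQ⟩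
    have hgu : a.applySub g = a.applySub u := by
      refine FOAtom.applySub_congr fun v hv => dif_neg ?_
      rintro ⟨z, hz, hzv⟩
      rcases hex z hz _ hzv with h | ⟨w, h, -, hw⟩
      · rw [FOTerm.var.injEq] at h
        subst h
        exact hne v (mem_varsFS.2 ⟨a, ha, hv⟩) (Finset.mem_sdiff.1 hz).1
      · rw [FOTerm.var.injEq] at h
        subst h
        exact hw (mem_varsFS.2 ⟨a, haD, hv⟩)
    rw [hgu]
    exact Finset.mem_union_left _ (hF (Finset.mem_image_of_mem _ haD))

theorem applySubFS_sdiff_subset_betaRw (R : DisjRule P V C) (μ : DisjPieceUnif P V C)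
    (u : FOSubst V C) {i : ℕ} (h₁ : i < μ.Qs.length) (h₂ : i < μ.mus.length) :
    applySubFS u (μ.Qs[i] \ μ.mus[i].Q') ⊆ betaRw R μ u := by
  have hfold : ∀ (l : List (Finset (FOAtom P V C))), ∀ S ∈ l, S ⊆ l.foldr (· ∪ ·) ∅ := by
    intro l
    induction l with
    | nil => simp
    | cons T l ih =>
      intro S hS
      rcases List.mem_cons.1 hS with rfl | hS
      · exact Finset.subset_union_left
      · exact (ih S hS).trans Finset.subset_union_right
  refine Finset.Subset.trans (hfold _ _ ?_) Finset.subset_union_right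
  refine List.mem_iff_getElem.2 ⟨i, by simp [h₁, h₂], by simp⟩

end PieceUnifier

/-- for a disjunctive piece-unifier `μ_∨` of a UCQ `𝒬` with `R` and
`F = β_∨(𝒬, R, μ_∨)`, there is a trigger `(R, h)` on `F` such that
`α_∨(F, R, h) ⊨ 𝒬`. -/
theorem stmt4 {P V C : Type} [DecidableEq P] [DecidableEq V] [DecidableEq C] [Infinite V]
    (𝒬 : Finset (Finset (FOAtom P V C))) (R : DisjRule P V C) (hWF : R.WF)
    (μ : DisjPieceUnif P V C)
    (hμ : IsDisjPieceUnifier (↑𝒬 : Set (Finset (FOAtom P V C))) R μ)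
    (u : FOSubst V C) (hu : IsAssocSub μ.rel u) :
    ∃ h : FOSubst V C, IsTrigger R h (betaRw R μ u) ∧
      ∃ L : List (Finset (FOAtom P V C)), IsAlpha (betaRw R μ u) R h L ∧
        ∀ G ∈ L, ∃ Q ∈ 𝒬, EntailsFS G Q := by
  obtain ⟨hQl, hml, hcopy, hdisj, -, hunif, -⟩ := hμ
  choose ext hext using fun H => exists_isSafeExt (betaRw R μ u) R H u
  refine ⟨u, fun a ha => Finset.mem_union_left _ (Finset.mem_image_of_mem _ ha),
    R.heads.map fun H => betaRw R μ u ∪ applySubFS (ext H) H,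
    ⟨List.length_map _, fun i hi hi' => ⟨_, hext _, by simp⟩⟩, fun G hG => ?_⟩
  obtain ⟨H, hH, rfl⟩ := List.mem_map.1 hG
  obtain ⟨i, hi, rfl⟩ := List.mem_iff_getElem.1 hH
  have h₁ : i < μ.Qs.length := hQl ▸ hi
  have h₂ : i < μ.mus.length := hml ▸ hi
  obtain ⟨Q, hQ, hc⟩ := hcopy i h₁
  refine ⟨Q, hQ, EntailsFS.of_isSafeCopy hc ?_⟩
  refine (hunif i hi h₁ h₂).entailsFS hH (hdisj i h₁) (fun s t hst => hu.1 s t ?_)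
    (applySubFS_sdiff_subset_betaRw R μ u h₁ h₂) (hext _)
  exact Relation.EqvGen.rel _ _ ⟨_, List.mem_map_of_mem (List.get_mem _ _), hst⟩
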